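/- arXiv:2603.18253 — 6 statements merged into one kernel-verified Lean document; each statement's English description precedes it below -/
import Mathlib

section
/- Suppose the following two hypotheses hold. (A) For all positive integers n1, k1, n2, k2 with n1·k2 = n2·k1, all finite types E1, E2 of cardinality n1·k2, and all functions u1 : E1 → Fin n1, v1 : E1 → Fin k1, u2 : E2 → Fin n2, v2 : E2 → Fin k2 such that every fiber of u1 has k2 elements, every fiber of v1 has n2 elements, every fiber of u2 has k1 elements, and every fiber of v2 has n1 elements, there exists a bijection ψ : E1 ≃ E2 such that for every (x, y) : Fin n2 × Fin k1 there is exactly one e : E1 with u2 (ψ e) = x and v1 e = y, and for every (x, y) : Fin n1 × Fin k2 there is exactly one e : E2 with u1 (ψ⁻¹ e) = x and v2 e = y. (B) For all positive integers n, k and every biregular pair (u, v) on parameters (n, k) such that the simple graph on (Fin n) ⊕ (Fin k) in which Sum.inl x is adjacent to Sum.inr y iff there exists e with u e = x and v e = y (and with no other adjacencies) is connected, there exists an involution ι on Fin n × Fin k such that for every (x, y) there is exactly one e with u (ι e) = x and v e = y. Then for all positive integers n, k and every biregular pair (u, v) on parameters (n, k) there exists an involution ι on Fin n × Fin k such that for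 every (x, y) there is exactly one e with u (ι e) = x and v e = y. -/
open Finset in
/-- A nonempty regular bipartite multigraph contains a perfect matching. -/
lemma exists_perfectMatching_subset {E X Y : Type*} [Fintype X] [Fintype Y]
    [DecidableEq E] [DecidableEq X] [DecidableEq Y] (f : E → X) (g : E → Y) (S : Finset E)
    {c : ℕ} (hc : 0 < c) (hf : ∀ x, #{e ∈ S | f e = x} = c) (hg : ∀ y, #{e ∈ S | g e = y} = c) :
    ∃ M ⊆ S, (∀ x, #{e ∈ M | f e = x} = 1) ∧ ∀ y, #{e ∈ M | g e = y} = 1 := by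
  have hcard : Fintype.card X = Fintype.card Y := by
    have h1 : #S = ∑ x : X, #{e ∈ S | f e = x} :=
      card_eq_sum_card_fiberwise fun _ _ => by simp
    have h2 : #S = ∑ y : Y, #{e ∈ S | g e = y} :=
      card_eq_sum_card_fiberwise fun _ _ => by simp
    simp only [hf, hg, sum_const, card_univ, smul_eq_mul] at h1 h2
    exact Nat.eq_of_mul_eq_mul_right hc (h1.symm.trans h2)
  obtain ⟨m, hm, hmt⟩ := (all_card_le_biUnion_card_iff_exists_injective
    fun x : X => image g {e ∈ S | f e = x}).1 fun A => by
      set B := A.biUnion fun x : X => image g {e ∈ S | f e = x} with hB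
      have h1 : #{e ∈ S | f e ∈ A} = ∑ x ∈ A, #{e ∈ {e ∈ S | f e ∈ A} | f e = x} :=
        card_eq_sum_card_fiberwise fun e he => by simpa using (mem_filter.1 he).2
      have h2 : #{e ∈ S | g e ∈ B} = ∑ y ∈ B, #{e ∈ {e ∈ S | g e ∈ B} | g e = y} :=
        card_eq_sum_card_fiberwise fun e he => by simpa using (mem_filter.1 he).2
      have h3 : ∀ x ∈ A, #{e ∈ {e ∈ S | f e ∈ A} | f e = x} = c := fun x hx => by
        rw [← hf x]; congr 1; grind
      have h4 : ∀ y ∈ B, #{e ∈ {e ∈ S | g e ∈ B} | g e = y} = c := fun y hy => by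
        rw [← hg y]; congr 1; grind
      rw [sum_congr rfl h3, sum_const, smul_eq_mul] at h1
      rw [sum_congr rfl h4, sum_const, smul_eq_mul] at h2
      have h5 : #{e ∈ S | f e ∈ A} ≤ #{e ∈ S | g e ∈ B} := card_le_card fun e he => by
        simp only [mem_filter] at he ⊢
        exact ⟨he.1, mem_biUnion.2 ⟨f e, he.2, mem_image_of_mem g (by simp [he.1])⟩⟩
      exact Nat.le_of_mul_le_mul_right (h1 ▸ h2 ▸ h5) hc
  have hbij : Function.Bijective m := (Fintype.bijective_iff_injective_and_card m).2 ⟨hm, hcard⟩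
  simp only [mem_image, mem_filter] at hmt
  choose e he hge using hmt
  refine ⟨univ.image e, fun a ha => ?_, fun x => card_eq_one.2 ⟨e x, ?_⟩, fun y => ?_⟩
  · obtain ⟨x, -, rfl⟩ := mem_image.1 ha
    exact (he x).1
  · ext a
    simp only [mem_filter, mem_image, mem_univ, true_and, mem_singleton]
    constructor
    · rintro ⟨⟨x', rfl⟩, h⟩
      rw [← h, (he x').2]
    · rintro rfl
      exact ⟨⟨x, rfl⟩, (he x).2⟩
  · obtain ⟨x, rfl⟩ := hbij.2 y
    refine card_eq_one.2 ⟨e x, ?_⟩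
    ext a
    simp only [mem_filter, mem_image, mem_univ, true_and, mem_singleton]
    constructor
    · rintro ⟨⟨x', rfl⟩, h⟩
      rw [hm ((hge x').symm.trans h)]
    · rintro rfl
      exact ⟨⟨x, rfl⟩, hge x⟩

open Finset in
lemma card_filter_compl {E : Type*} [Fintype E] [DecidableEq E] (P : E → Prop) [DecidablePred P]
    (F : Finset E) : #{e ∈ Fᶜ | P e} = #{e | P e} - #{e ∈ F | P e} := by
  rw [← card_sdiff_of_subset (filter_subset_filter P (subset_univ F))]
  congr 1
  ext e
  simp only [mem_filter, mem_compl, mem_sdiff, mem_univ, true_and]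
  tauto

open Finset in
/-- A `d`-regular bipartite multigraph contains an `r`-factor for every `r ≤ d`. -/
lemma exists_factor_of_regular {E X Y : Type*} [Fintype E] [Fintype X] [Fintype Y]
    [DecidableEq E] [DecidableEq X] [DecidableEq Y] (f : E → X) (g : E → Y) {d : ℕ}
    (hf : ∀ x, #{e | f e = x} = d) (hg : ∀ y, #{e | g e = y} = d) {r : ℕ} (hr : r ≤ d) :
    ∃ F : Finset E, (∀ x, #{e ∈ F | f e = x} = r) ∧ ∀ y, #{e ∈ F | g e = y} = r := by
  induction r with
  | zero => exact ⟨∅, by simp⟩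
  | succ r ih =>
    obtain ⟨F, hFf, hFg⟩ := ih (by omega)
    obtain ⟨M, hM, hMf, hMg⟩ := exists_perfectMatching_subset f g Fᶜ (c := d - r) (by omega)
      (fun x => by rw [card_filter_compl, hf, hFf]) (fun y => by rw [card_filter_compl, hg, hFg])
    have hdisj : Disjoint F M := by
      rw [disjoint_left]; exact fun a ha ha' => mem_compl.1 (hM ha') ha
    refine ⟨F ∪ M, fun x => ?_, fun y => ?_⟩
    · rw [filter_union, card_union_of_disjoint (disjoint_filter_filter hdisj), hFf, hMf]
    · rw [filter_union, card_union_of_disjoint (disjoint_filter_filter hdisj), hFg, hMg]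

open Finset in
/-- If every fiber of `f` has `b * d` elements, each of them can be cut into `b` pieces of
size `d`. -/
lemma exists_refinement_of_card_fiber {E X : Type*} [Fintype E] [DecidableEq X]
    (f : E → X) {b d : ℕ} (hf : ∀ x, #{e | f e = x} = b * d) :
    ∃ f' : E → X × Fin b, (∀ e, (f' e).1 = f e) ∧ ∀ z, #{e | f' e = z} = d := by
  classical
  have φ : ∀ x, {e // f e = x} ≃ Fin b × Fin d := fun x =>
    Fintype.equivOfCardEq (by rw [Fintype.card_subtype, hf]; simp)
  refine ⟨fun e => (f e, (φ (f e) ⟨e, rfl⟩).1), fun e => rfl, fun ⟨x, i⟩ => ?_⟩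
  have hinj : Function.Injective fun j : Fin d => ((φ x).symm (i, j) : E) := fun j j' h => by
    simpa using (φ x).symm.injective (Subtype.ext h)
  refine Eq.trans (congrArg card ?_) ((card_image_of_injective univ hinj).trans (card_fin d))
  ext e
  simp only [mem_filter, mem_univ, true_and, mem_image, Prod.mk.injEq]
  constructor
  · rintro ⟨rfl, rfl⟩
    exact ⟨(φ (f e) ⟨e, rfl⟩).2, by simp⟩
  · rintro ⟨j, rfl⟩
    have h := ((φ x).symm (i, j)).2
    refine ⟨h, ?_⟩
    have : ∀ (x' : X) (h' : f ((φ x).symm (i, j)) = x'), x = x' →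
        (φ x' ⟨(φ x).symm (i, j), h'⟩).1 = i := by
      rintro x' h' rfl
      simp
    exact this _ rfl h.symm

open Finset in
lemma ncard_fiber_of_refinement {E Z : Type*} [DecidableEq Z] {c m : ℕ} (w : E → Z)
    (w' : E → Z × Fin c) (h : ∀ e, (w' e).1 = w e) (F : Finset E)
    (h' : ∀ z, #{e ∈ F | w' e = z} = m) (z : Z) :
    {e | e ∈ (F : Set E) ∧ w e = z}.ncard = c * m := by
  have h1 : #{e ∈ F | w e = z} =
      ∑ i : Fin c, #{e ∈ {e ∈ F | w e = z} | (w' e).2 = i} :=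
    card_eq_sum_card_fiberwise fun _ _ => by simp
  have h2 : ∀ i : Fin c, #{e ∈ {e ∈ F | w e = z} | (w' e).2 = i} = m := fun i => by
    rw [← h' (z, i), filter_filter]
    congr 1
    ext e
    simp [Prod.ext_iff, h]
  simp only [h2, sum_const, card_univ, Fintype.card_fin, smul_eq_mul] at h1
  rw [← h1, ← Set.ncard_coe_finset]
  simp

open Finset in
/-- A bipartite multigraph with degrees `b * d` on one side and `a * d` on the other has, for
every `m ≤ d`, a subgraph with degrees `b * m` and `a * m`. -/
lemma exists_biregular_subgraph {E X Y : Type*} [Finite E] [Finite X] [Finite Y]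
    (u : E → X) (v : E → Y) {a b d m : ℕ} (hu : ∀ x, {e | u e = x}.ncard = b * d)
    (hv : ∀ y, {e | v e = y}.ncard = a * d) (hm : m ≤ d) :
    ∃ F : Set E, (∀ x, {e | e ∈ F ∧ u e = x}.ncard = b * m) ∧
      ∀ y, {e | e ∈ F ∧ v e = y}.ncard = a * m := by
  classical
  have := Fintype.ofFinite E
  have := Fintype.ofFinite X
  have := Fintype.ofFinite Y
  obtain ⟨u', hu', hu''⟩ := exists_refinement_of_card_fiber u (b := b) (d := d)
    fun x => by rw [← hu x, ← Set.ncard_coe_finset]; simp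
  obtain ⟨v', hv', hv''⟩ := exists_refinement_of_card_fiber v (b := a) (d := d)
    fun y => by rw [← hv y, ← Set.ncard_coe_finset]; simp
  obtain ⟨F, hF, hF'⟩ := exists_factor_of_regular u' v' hu'' hv'' hm
  exact ⟨F, ncard_fiber_of_refinement u u' hu' F hF,
    ncard_fiber_of_refinement v v' hv' F hF'⟩

/-- An involution `ι` of the edges such that `(u (ι e), v e)` runs exactly once through all pairs
of vertices. -/
def HasPairingInvolution {E X Y : Type*} (u : E → X) (v : E → Y) : Prop :=
  ∃ ι : E → E, ι ∘ ι = id ∧ ∀ (x : X) (y : Y), ∃! e : E, u (ι e) = x ∧ v e = y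

/-- The bipartite multigraph of `(u, v)` has no union of connected components other than the
empty one and the whole graph. -/
def IsIndecomposable {E X Y : Type*} (u : E → X) (v : E → Y) : Prop :=
  ∀ (p : Set X) (q : Set Y), (∀ e, u e ∈ p ↔ v e ∈ q) →
    (p = Set.univ ∧ q = Set.univ) ∨ (p = ∅ ∧ q = ∅)

/-- A bijection between the edges of two bipartite multigraphs that pairs the vertices of each
of them with those of the other. -/
def HasPairingEquiv {E₁ E₂ X₁ Y₁ X₂ Y₂ : Type*} (u₁ : E₁ → X₁) (v₁ : E₁ → Y₁)
    (u₂ : E₂ → X₂) (v₂ : E₂ → Y₂) : Prop :=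
  ∃ ψ : E₁ ≃ E₂, (∀ (x : X₂) (y : Y₁), ∃! e : E₁, u₂ (ψ e) = x ∧ v₁ e = y) ∧
    ∀ (x : X₁) (y : Y₂), ∃! e : E₂, u₁ (ψ.symm e) = x ∧ v₂ e = y

lemma ncard_fiber_comp_equiv {E E' X X' : Type*} (u : E → X) (f : E' ≃ E) (g : X ≃ X') (x : X') :
    {e | g (u (f e)) = x}.ncard = {e | u e = g.symm x}.ncard := by
  rw [← Nat.card_coe_set_eq, ← Nat.card_coe_set_eq]
  exact Nat.card_congr (f.subtypeEquiv fun e => by simp [Equiv.eq_symm_apply])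

lemma card_eq_mul_of_ncard_fiber {E X : Type*} [Finite E] [Finite X] (u : E → X) {k : ℕ}
    (h : ∀ x, {e | u e = x}.ncard = k) : Nat.card E = Nat.card X * k := by
  have := Fintype.ofFinite X
  rw [← Nat.card_congr (Equiv.sigmaFiberEquiv u), Nat.card_sigma]
  have : ∀ x, Nat.card {e // u e = x} = k := h
  simp [this]

lemma HasPairingInvolution.of_equiv {E E' X X' Y Y' : Type*} {u : E → X} {v : E → Y}
    (f : E' ≃ E) (g : X ≃ X') (h : Y ≃ Y')
    (H : HasPairingInvolution (fun e => g (u (f e))) fun e => h (v (f e))) :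
    HasPairingInvolution u v := by
  obtain ⟨ι, hι, H⟩ := H
  refine ⟨fun e => f (ι (f.symm e)), ?_, fun x y => ?_⟩
  · funext e
    simpa using congrArg f (congrFun hι (f.symm e))
  · obtain ⟨e, ⟨h1, h2⟩, h3⟩ := H (g x) (h y)
    refine ⟨f e, ⟨by simpa using h1, by simpa using h2⟩, fun e' ⟨h1', h2'⟩ => ?_⟩
    rw [← h3 (f.symm e') ⟨by simp [h1'], by simp [h2']⟩]
    simp

lemma HasPairingEquiv.of_equiv {E₁ E₂ X₁ Y₁ X₂ Y₂ X₁' Y₁' X₂' Y₂' : Type*} {u₁ : E₁ → X₁}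
    {v₁ : E₁ → Y₁} {u₂ : E₂ → X₂} {v₂ : E₂ → Y₂} (f₁ : X₁ ≃ X₁') (g₁ : Y₁ ≃ Y₁') (f₂ : X₂ ≃ X₂')
    (g₂ : Y₂ ≃ Y₂')
    (H : HasPairingEquiv (f₁ ∘ u₁) (g₁ ∘ v₁) (f₂ ∘ u₂) (g₂ ∘ v₂)) :
    HasPairingEquiv u₁ v₁ u₂ v₂ := by
  obtain ⟨ψ, h1, h2⟩ := H
  exact ⟨ψ, fun x y => by simpa using h1 (f₂ x) (g₁ y), fun x y => by simpa using h2 (f₁ x) (g₂ y)⟩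

lemma IsIndecomposable.comp_equiv {E E' X X' Y Y' : Type*} {u : E → X} {v : E → Y}
    (H : IsIndecomposable u v) (f : E' ≃ E) (g : X ≃ X') (h : Y ≃ Y') :
    IsIndecomposable (fun e => g (u (f e))) fun e => h (v (f e)) := by
  intro p q hpq
  have := H (g ⁻¹' p) (h ⁻¹' q) fun e => by simpa using hpq (f.symm e)
  simpa [Set.preimage_eq_empty_iff, Set.preimage_eq_univ_iff] using this

lemma IsIndecomposable.connected {E X Y : Type*} [Nonempty X] {u : E → X} {v : E → Y}
    (h : IsIndecomposable u v) :
    (SimpleGraph.fromRel fun A B : X ⊕ Y =>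
      ∃ (x : X) (y : Y), A = Sum.inl x ∧ B = Sum.inr y ∧ ∃ e : E, u e = x ∧ v e = y).Connected := by
  set G := SimpleGraph.fromRel fun A B : X ⊕ Y =>
    ∃ (x : X) (y : Y), A = Sum.inl x ∧ B = Sum.inr y ∧ ∃ e : E, u e = x ∧ v e = y with hG
  have hadj : ∀ e, G.Adj (Sum.inl (u e)) (Sum.inr (v e)) := fun e => by
    rw [hG, SimpleGraph.fromRel_adj]
    exact ⟨by simp, Or.inl ⟨_, _, rfl, rfl, e, rfl, rfl⟩⟩
  refine { preconnected := fun A B => ?_ }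
  rcases h {x | G.Reachable A (Sum.inl x)} {y | G.Reachable A (Sum.inr y)} fun e =>
    ⟨fun h => h.trans (hadj e).reachable, fun h => h.trans (hadj e).symm.reachable⟩ with
    ⟨hp, hq⟩ | ⟨hp, hq⟩
  · cases B with
    | inl x => exact Set.eq_univ_iff_forall.1 hp x
    | inr y => exact Set.eq_univ_iff_forall.1 hq y
  · cases A with
    | inl x => exact absurd (SimpleGraph.Reachable.refl _) (Set.eq_empty_iff_forall_notMem.1 hp x)
    | inr y => exact absurd (SimpleGraph.Reachable.refl _) (Set.eq_empty_iff_forall_notMem.1 hq y)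

lemma ncard_fiber_subtype {E X : Type*} (u : E → X) {P : E → Prop} {p : X → Prop}
    (h : ∀ e, P e → p (u e)) (x : {x // p x}) :
    {e : {e // P e} | (⟨u e, h e e.2⟩ : {x // p x}) = x}.ncard =
      {e | P e ∧ u e = x}.ncard := by
  rw [← Set.ncard_image_of_injective _ Subtype.val_injective]
  congr 1
  ext e
  simp only [Subtype.ext_iff, Set.mem_image, Set.mem_ofPred_eq, Subtype.exists]
  constructor
  · rintro ⟨e, he, h1, rfl⟩
    exact ⟨he, h1⟩
  · rintro ⟨he, h1⟩
    exact ⟨e, he, h1, rfl⟩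

open Classical in
/-- Pairings of the four parts of a decomposed multigraph fit together. -/
lemma HasPairingInvolution.glue {E X Y : Type*} {u : E → X} {v : E → Y} {p : X → Prop}
    {q : Y → Prop} (hpq : ∀ e, p (u e) ↔ q (v e)) (F : E → Prop)
    (h₁ : HasPairingInvolution
      (fun e : {e // p (u e) ∧ F e} => (⟨u e, e.2.1⟩ : {x // p x}))
      (fun e : {e // p (u e) ∧ F e} => (⟨v e, (hpq e).1 e.2.1⟩ : {y // q y})))
    (h₂ : HasPairingInvolution
      (fun e : {e // ¬ p (u e) ∧ F e} => (⟨u e, e.2.1⟩ : {x // ¬ p x}))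
      (fun e : {e // ¬ p (u e) ∧ F e} => (⟨v e, fun h => e.2.1 ((hpq e).2 h)⟩ : {y // ¬ q y})))
    (h : HasPairingEquiv
      (fun e : {e // p (u e) ∧ ¬ F e} => (⟨u e, e.2.1⟩ : {x // p x}))
      (fun e : {e // p (u e) ∧ ¬ F e} => (⟨v e, (hpq e).1 e.2.1⟩ : {y // q y}))
      (fun e : {e // ¬ p (u e) ∧ ¬ F e} => (⟨u e, e.2.1⟩ : {x // ¬ p x}))
      (fun e : {e // ¬ p (u e) ∧ ¬ F e} =>
        (⟨v e, fun h => e.2.1 ((hpq e).2 h)⟩ : {y // ¬ q y}))) :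
    HasPairingInvolution u v := by
  obtain ⟨ι₁, hι₁, H₁⟩ := h₁
  obtain ⟨ι₂, hι₂, H₂⟩ := h₂
  obtain ⟨ψ, H₃, H₄⟩ := h
  set ι : E → E := fun e =>
    if hp : p (u e) then if hF : F e then ι₁ ⟨e, hp, hF⟩ else ψ ⟨e, hp, hF⟩
    else if hF : F e then ι₂ ⟨e, hp, hF⟩ else ψ.symm ⟨e, hp, hF⟩ with hι
  have e₁ : ∀ e : {e // p (u e) ∧ F e}, ι e = ι₁ e := fun e => by simp [hι, e.2.1, e.2.2]
  have e₂ : ∀ e : {e // ¬ p (u e) ∧ F e}, ι e = ι₂ e := fun e => by simp [hι, e.2.1, e.2.2]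
  have e₃ : ∀ e : {e // p (u e) ∧ ¬ F e}, ι e = ψ e := fun e => by simp [hι, e.2.1, e.2.2]
  have e₄ : ∀ e : {e // ¬ p (u e) ∧ ¬ F e}, ι e = ψ.symm e := fun e => by
    simp [hι, e.2.1, e.2.2]
  clear_value ι
  have hcases : ∀ e, (∃ e' : {e // p (u e) ∧ F e}, e = e'.1) ∨
      (∃ e' : {e // ¬ p (u e) ∧ F e}, e = e'.1) ∨ (∃ e' : {e // p (u e) ∧ ¬ F e}, e = e'.1) ∨
      (∃ e' : {e // ¬ p (u e) ∧ ¬ F e}, e = e'.1) := fun e => by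
    simp only [Subtype.exists, exists_prop, exists_eq_right']
    tauto
  simp only [Subtype.ext_iff] at H₁ H₂ H₃ H₄
  refine ⟨ι, ?_, fun x y => ?_⟩
  · funext e
    rcases hcases e with ⟨e, rfl⟩ | ⟨e, rfl⟩ | ⟨e, rfl⟩ | ⟨e, rfl⟩
    · simpa [e₁] using congrArg Subtype.val (congrFun hι₁ e)
    · simpa [e₂] using congrArg Subtype.val (congrFun hι₂ e)
    · simp [e₃, e₄]
    · simp [e₃, e₄]
  · by_cases hx : p x <;> by_cases hy : q y
    · obtain ⟨e, ⟨h1, h2⟩, h3⟩ := H₁ ⟨x, hx⟩ ⟨y, hy⟩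
      refine ⟨e, ⟨by rw [e₁, h1], h2⟩, fun e' he' => ?_⟩
      rcases hcases e' with ⟨e', rfl⟩ | ⟨e', rfl⟩ | ⟨e', rfl⟩ | ⟨e', rfl⟩
      · exact congrArg _ (h3 e' ⟨by rw [← e₁, he'.1], he'.2⟩)
      · exact absurd ((hpq e').2 (he'.2 ▸ hy)) e'.2.1
      · exact absurd (he'.1 ▸ hx) (e₃ e' ▸ (ψ e').2.1)
      · exact absurd ((hpq e').2 (he'.2 ▸ hy)) e'.2.1
    · obtain ⟨e, ⟨h1, h2⟩, h3⟩ := H₄ ⟨x, hx⟩ ⟨y, hy⟩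
      refine ⟨e, ⟨by rw [e₄, h1], h2⟩, fun e' he' => ?_⟩
      rcases hcases e' with ⟨e', rfl⟩ | ⟨e', rfl⟩ | ⟨e', rfl⟩ | ⟨e', rfl⟩
      · exact absurd (he'.2 ▸ (hpq e').1 e'.2.1) hy
      · exact absurd (he'.1 ▸ hx) (e₂ e' ▸ (ι₂ e').2.1)
      · exact absurd (he'.2 ▸ (hpq e').1 e'.2.1) hy
      · exact congrArg _ (h3 e' ⟨by rw [← e₄, he'.1], he'.2⟩)
    · obtain ⟨e, ⟨h1, h2⟩, h3⟩ := H₃ ⟨x, hx⟩ ⟨y, hy⟩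
      refine ⟨e, ⟨by rw [e₃, h1], h2⟩, fun e' he' => ?_⟩
      rcases hcases e' with ⟨e', rfl⟩ | ⟨e', rfl⟩ | ⟨e', rfl⟩ | ⟨e', rfl⟩
      · exact absurd (he'.1 ▸ e₁ e' ▸ (ι₁ e').2.1) hx
      · exact absurd ((hpq e').2 (he'.2 ▸ hy)) e'.2.1
      · exact congrArg _ (h3 e' ⟨by rw [← e₃, he'.1], he'.2⟩)
      · exact absurd ((hpq e').2 (he'.2 ▸ hy)) e'.2.1
    · obtain ⟨e, ⟨h1, h2⟩, h3⟩ := H₂ ⟨x, hx⟩ ⟨y, hy⟩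
      refine ⟨e, ⟨by rw [e₂, h1], h2⟩, fun e' he' => ?_⟩
      rcases hcases e' with ⟨e', rfl⟩ | ⟨e', rfl⟩ | ⟨e', rfl⟩ | ⟨e', rfl⟩
      · exact absurd (he'.2 ▸ (hpq e').1 e'.2.1) hy
      · exact congrArg _ (h3 e' ⟨by rw [← e₂, he'.1], he'.2⟩)
      · exact absurd (he'.2 ▸ (hpq e').1 e'.2.1) hy
      · exact absurd (he'.1 ▸ e₄ e' ▸ (ψ.symm e').2.1) hx

lemma exists_common_factor {n₁ n₂ k₁ k₂ : ℕ} (hn : 0 < n₁ + n₂)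
    (h : n₁ * k₂ = n₂ * k₁) :
    ∃ a b m₁ m₂, n₁ = a * m₁ ∧ n₂ = a * m₂ ∧ k₁ = b * m₁ ∧ k₂ = b * m₂ := by
  obtain ⟨g, a, b, hg, hab, ha, hb⟩ :=
    Nat.exists_coprime' (Nat.gcd_pos_of_pos_left (k₁ + k₂) hn)
  have ha0 : 0 < a := Nat.pos_of_mul_pos_right (ha ▸ hn)
  have h1 : n₁ * b = k₁ * a := Nat.eq_of_mul_eq_mul_right hg (by
    rw [mul_assoc, mul_assoc, ← ha, ← hb]; linarith)
  obtain ⟨m₁, rfl⟩ : a ∣ n₁ := hab.dvd_of_dvd_mul_right ⟨k₁, by rw [h1, mul_comm]⟩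
  have hk₁ : k₁ = b * m₁ := Nat.eq_of_mul_eq_mul_right ha0 (by rw [← h1]; ring)
  have hm : m₁ ≤ g := Nat.le_of_mul_le_mul_left (ha ▸ Nat.le_add_right _ _) ha0
  obtain ⟨m₂, rfl⟩ := Nat.exists_eq_add_of_le hm
  exact ⟨a, b, m₁, m₂, rfl, by rw [mul_add] at ha; omega, hk₁,
    by rw [mul_add] at hb; omega⟩

/-- Reduction to indecomposable multigraphs: a decomposable one is cut into two pairs of smaller
biregular multigraphs. -/
lemma hasPairingInvolution_of_indecomposable
    (hFour : ∀ (E₁ E₂ X₁ Y₁ X₂ Y₂ : Type) [Finite E₁] [Finite E₂] [Finite X₁] [Finite Y₁]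
      [Finite X₂] [Finite Y₂] [Nonempty X₁] [Nonempty Y₁] [Nonempty X₂] [Nonempty Y₂]
      (u₁ : E₁ → X₁) (v₁ : E₁ → Y₁) (u₂ : E₂ → X₂) (v₂ : E₂ → Y₂),
      (∀ x, {e | u₁ e = x}.ncard = Nat.card Y₂) → (∀ y, {e | v₁ e = y}.ncard = Nat.card X₂) →
      (∀ x, {e | u₂ e = x}.ncard = Nat.card Y₁) → (∀ y, {e | v₂ e = y}.ncard = Nat.card X₁) →
      HasPairingEquiv u₁ v₁ u₂ v₂)
    (hInd : ∀ (E X Y : Type) [Finite E] [Finite X] [Finite Y] [Nonempty X] [Nonempty Y]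
      (u : E → X) (v : E → Y), (∀ x, {e | u e = x}.ncard = Nat.card Y) →
      (∀ y, {e | v e = y}.ncard = Nat.card X) → IsIndecomposable u v → HasPairingInvolution u v)
    (E X Y : Type) [Finite E] [Finite X] [Finite Y] [Nonempty X] [Nonempty Y]
    (u : E → X) (v : E → Y) (hu : ∀ x, {e | u e = x}.ncard = Nat.card Y)
    (hv : ∀ y, {e | v e = y}.ncard = Nat.card X) : HasPairingInvolution u v := by
  induction hN : Nat.card X using Nat.strong_induction_on generalizing E X Y with
  | _ N ih =>
  subst hN
  by_cases hdec : IsIndecomposable u v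
  · exact hInd E X Y u v hu hv hdec
  classical
  simp only [IsIndecomposable, not_forall] at hdec
  obtain ⟨p, q, hpq, hne⟩ := hdec
  have hX : Nat.card {x // x ∈ p} + Nat.card {x // x ∉ p} = Nat.card X := by
    rw [← Nat.card_sum]; exact Nat.card_congr (Equiv.sumCompl _)
  have hY : Nat.card {y // y ∈ q} + Nat.card {y // y ∉ q} = Nat.card Y := by
    rw [← Nat.card_sum]; exact Nat.card_congr (Equiv.sumCompl _)
  have hX0 : 0 < Nat.card X := Nat.card_pos
  have hY0 : 0 < Nat.card Y := Nat.card_pos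
  have hcount : Nat.card {x // x ∈ p} * Nat.card Y = Nat.card {y // y ∈ q} * Nat.card X := by
    rw [← card_eq_mul_of_ncard_fiber
      (fun e : {e // u e ∈ p} => (⟨u e, e.2⟩ : {x // x ∈ p})) fun x => ?_,
      ← card_eq_mul_of_ncard_fiber
      (fun e : {e // u e ∈ p} => (⟨v e, (hpq e).1 e.2⟩ : {y // y ∈ q})) fun y => ?_]
    · rw [ncard_fiber_subtype v fun e he => (hpq e).1 he, ← hv y]
      congr 1; ext e; have := y.2; have := hpq e; grind
    · rw [ncard_fiber_subtype u fun e he => he, ← hu x]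
      congr 1; ext e; have := x.2; grind
  have hmul : Nat.card {x // x ∈ p} * Nat.card {y // y ∉ q} =
      Nat.card {x // x ∉ p} * Nat.card {y // y ∈ q} := by
    rw [← hX, ← hY] at hcount; linarith
  have hpos : 0 < Nat.card {x // x ∈ p} ∧ 0 < Nat.card {y // y ∈ q} ∧
      0 < Nat.card {x // x ∉ p} ∧ 0 < Nat.card {y // y ∉ q} := by
    have key₁ : Nat.card {x // x ∈ p} = 0 ↔ Nat.card {y // y ∈ q} = 0 := by
      constructor <;> intro h <;> rw [h, zero_mul] at hcount
      · exact (mul_eq_zero.1 hcount.symm).resolve_right hX0.ne'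
      · exact (mul_eq_zero.1 hcount).resolve_right hY0.ne'
    have hcount' : Nat.card {x // x ∉ p} * Nat.card Y = Nat.card {y // y ∉ q} * Nat.card X := by
      rw [← hX, ← hY]; linarith
    have key₂ : Nat.card {x // x ∉ p} = 0 ↔ Nat.card {y // y ∉ q} = 0 := by
      constructor <;> intro h <;> rw [h, zero_mul] at hcount'
      · exact (mul_eq_zero.1 hcount'.symm).resolve_right hX0.ne'
      · exact (mul_eq_zero.1 hcount').resolve_right hY0.ne'
    have h₁ : ¬ (Nat.card {x // x ∈ p} = 0 ∧ Nat.card {y // y ∈ q} = 0) := fun ⟨h, h'⟩ => by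
      exact hne (Or.inr ⟨(Set.ncard_eq_zero p.toFinite).1 h, (Set.ncard_eq_zero q.toFinite).1 h'⟩)
    have h₂ : ¬ (Nat.card {x // x ∉ p} = 0 ∧ Nat.card {y // y ∉ q} = 0) := fun ⟨h, h'⟩ => by
      refine hne (Or.inl ⟨?_, ?_⟩)
      · simpa [Finite.card_eq_zero_iff, Set.eq_univ_iff_forall, isEmpty_subtype] using h
      · simpa [Finite.card_eq_zero_iff, Set.eq_univ_iff_forall, isEmpty_subtype] using h'
    omega
  obtain ⟨hp, hq, hp', hq'⟩ := hpos
  have := (Nat.card_pos_iff.1 hp).1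
  have := (Nat.card_pos_iff.1 hq).1
  have := (Nat.card_pos_iff.1 hp').1
  have := (Nat.card_pos_iff.1 hq').1
  obtain ⟨a, b, m₁, m₂, ha₁, ha₂, hb₁, hb₂⟩ := exists_common_factor (by omega) hmul
  have hu' : ∀ x, {e | u e = x}.ncard = b * (m₁ + m₂) := fun x => by
    rw [hu, ← hY, hb₁, hb₂, mul_add]
  have hv' : ∀ y, {e | v e = y}.ncard = a * (m₁ + m₂) := fun y => by
    rw [hv, ← hX, ha₁, ha₂, mul_add]
  obtain ⟨F₁, hF₁u, hF₁v⟩ := exists_biregular_subgraph u v hu' hv' (Nat.le_add_right m₁ m₂)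
  obtain ⟨F₂, hF₂u, hF₂v⟩ := exists_biregular_subgraph u v hu' hv' (Nat.le_add_left m₂ m₁)
  have compl : ∀ {Z : Type} (w : E → Z) (z : Z) (F : Set E) (c s t : ℕ),
      {e | w e = z}.ncard = c * (s + t) → {e | e ∈ F ∧ w e = z}.ncard = c * s →
      {e | e ∉ F ∧ w e = z}.ncard = c * t := fun w z F c s t h1 h2 => by
    have h3 := Set.ncard_inter_add_ncard_sdiff_eq_ncard {e | w e = z} F
    have h4 : {e | w e = z} ∩ F = {e | e ∈ F ∧ w e = z} := by ext; simp [and_comm]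
    have h5 : {e | w e = z} \ F = {e | e ∉ F ∧ w e = z} := by ext; simp [and_comm]
    rw [h4, h5, h1, h2, mul_add] at h3
    omega
  refine HasPairingInvolution.glue (p := (· ∈ p)) (q := (· ∈ q)) hpq
    (fun e => if u e ∈ p then e ∈ F₁ else e ∈ F₂) ?_ ?_ ?_
  · refine ih _ (by omega) _ _ _ _ _ (fun x => ?_) (fun y => ?_) rfl
    · rw [ncard_fiber_subtype u fun e he => he.1, hb₁, ← hF₁u x]
      congr 1; ext e; have := x.2; grind
    · rw [ncard_fiber_subtype v fun e he => (hpq e).1 he.1, ha₁, ← hF₁v y]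
      congr 1; ext e; have := y.2; have := hpq e; grind
  · refine ih _ (by omega) _ _ _ _ _ (fun x => ?_) (fun y => ?_) rfl
    · rw [ncard_fiber_subtype u fun e he => he.1, hb₂, ← hF₂u x]
      congr 1; ext e; have := x.2; grind
    · rw [ncard_fiber_subtype v fun e he h => he.1 ((hpq e).2 h), ha₂, ← hF₂v y]
      congr 1; ext e; have := y.2; have := hpq e; grind
  · refine hFour _ _ _ _ _ _ _ _ _ _ (fun x => ?_) (fun y => ?_) (fun x => ?_) (fun y => ?_)
    · rw [ncard_fiber_subtype u fun e he => he.1, hb₂, ← compl u x F₁ b m₁ m₂ (hu' x) (hF₁u x)]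
      congr 1; ext e; have := x.2; grind
    · rw [ncard_fiber_subtype v fun e he => (hpq e).1 he.1, ha₂,
        ← compl v y F₁ a m₁ m₂ (hv' y) (hF₁v y)]
      congr 1; ext e; have := y.2; have := hpq e; grind
    · rw [ncard_fiber_subtype u fun e he => he.1, hb₁,
        ← compl u x F₂ b m₂ m₁ (add_comm m₁ m₂ ▸ hu' x) (hF₂u x)]
      congr 1; ext e; have := x.2; grind
    · rw [ncard_fiber_subtype v fun e he h => he.1 ((hpq e).2 h), ha₁,
        ← compl v y F₂ a m₂ m₁ (add_comm m₁ m₂ ▸ hv' y) (hF₂v y)]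
      congr 1; ext e; have := y.2; have := hpq e; grind

/-- if Conjecture 5 (four parts) holds and Conjecture 3 (balls) holds for
connected multigraphs, then Conjecture 3 holds in general. -/
theorem stmt14
    (hFourParts : ∀ (n1 k1 n2 k2 : ℕ), 0 < n1 → 0 < k1 → 0 < n2 → 0 < k2 →
      n1 * k2 = n2 * k1 →
      ∀ (E1 E2 : Type) [Fintype E1] [Fintype E2],
        Fintype.card E1 = n1 * k2 → Fintype.card E2 = n1 * k2 →
        ∀ (u1 : E1 → Fin n1) (v1 : E1 → Fin k1) (u2 : E2 → Fin n2) (v2 : E2 → Fin k2),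
          (∀ x : Fin n1, Nat.card {e : E1 | u1 e = x} = k2) →
          (∀ y : Fin k1, Nat.card {e : E1 | v1 e = y} = n2) →
          (∀ x : Fin n2, Nat.card {e : E2 | u2 e = x} = k1) →
          (∀ y : Fin k2, Nat.card {e : E2 | v2 e = y} = n1) →
          ∃ ψ : E1 ≃ E2,
            (∀ (x : Fin n2) (y : Fin k1), ∃! e : E1, u2 (ψ e) = x ∧ v1 e = y) ∧
            (∀ (x : Fin n1) (y : Fin k2), ∃! e : E2, u1 (ψ.symm e) = x ∧ v2 e = y))
    (hConnBalls : ∀ (n k : ℕ), 0 < n → 0 < k →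
      ∀ (u : Fin n × Fin k → Fin n) (v : Fin n × Fin k → Fin k),
        (∀ x : Fin n, Nat.card {e : Fin n × Fin k | u e = x} = k) →
        (∀ y : Fin k, Nat.card {e : Fin n × Fin k | v e = y} = n) →
        (SimpleGraph.fromRel fun A B : Fin n ⊕ Fin k =>
          ∃ (x : Fin n) (y : Fin k), A = Sum.inl x ∧ B = Sum.inr y ∧
            ∃ e : Fin n × Fin k, u e = x ∧ v e = y).Connected →
        ∃ ι : Fin n × Fin k → Fin n × Fin k, ι ∘ ι = id ∧
          ∀ (x : Fin n) (y : Fin k), ∃! e : Fin n × Fin k, u (ι e) = x ∧ v e = y) :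
    ∀ (n k : ℕ), 0 < n → 0 < k →
      ∀ (u : Fin n × Fin k → Fin n) (v : Fin n × Fin k → Fin k),
        (∀ x : Fin n, Nat.card {e : Fin n × Fin k | u e = x} = k) →
        (∀ y : Fin k, Nat.card {e : Fin n × Fin k | v e = y} = n) →
        ∃ ι : Fin n × Fin k → Fin n × Fin k, ι ∘ ι = id ∧
          ∀ (x : Fin n) (y : Fin k), ∃! e : Fin n × Fin k, u (ι e) = x ∧ v e = y := by
  intro n k hn hk u v hu hv
  have : Nonempty (Fin n) := ⟨⟨0, hn⟩⟩
  have : Nonempty (Fin k) := ⟨⟨0, hk⟩⟩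
  refine hasPairingInvolution_of_indecomposable ?_ ?_ _ _ _ u v
    (fun x => by rw [← Nat.card_coe_set_eq, hu, Nat.card_fin])
    (fun y => by rw [← Nat.card_coe_set_eq, hv, Nat.card_fin])
  · intro E₁ E₂ X₁ Y₁ X₂ Y₂ _ _ _ _ _ _ _ _ _ _ u₁ v₁ u₂ v₂ hu₁ hv₁ hu₂ hv₂
    have := Fintype.ofFinite E₁
    have := Fintype.ofFinite E₂
    have cu₁ := card_eq_mul_of_ncard_fiber u₁ hu₁
    have cv₁ := card_eq_mul_of_ncard_fiber v₁ hv₁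
    have cv₂ := card_eq_mul_of_ncard_fiber v₂ hv₂
    refine HasPairingEquiv.of_equiv (Finite.equivFin X₁) (Finite.equivFin Y₁)
      (Finite.equivFin X₂) (Finite.equivFin Y₂) (hFourParts _ _ _ _ Nat.card_pos Nat.card_pos
        Nat.card_pos Nat.card_pos ?_ E₁ E₂ ?_ ?_ _ _ _ _ (fun x => ?_) (fun y => ?_)
        (fun x => ?_) (fun y => ?_))
    · rw [← cu₁, cv₁, mul_comm]
    · rw [← cu₁, Nat.card_eq_fintype_card]
    · rw [mul_comm, ← cv₂, Nat.card_eq_fintype_card]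
    · exact (ncard_fiber_comp_equiv u₁ (Equiv.refl _) _ x).trans (hu₁ _)
    · exact (ncard_fiber_comp_equiv v₁ (Equiv.refl _) _ y).trans (hv₁ _)
    · exact (ncard_fiber_comp_equiv u₂ (Equiv.refl _) _ x).trans (hu₂ _)
    · exact (ncard_fiber_comp_equiv v₂ (Equiv.refl _) _ y).trans (hv₂ _)
  · intro E X Y _ _ _ _ _ u v hu hv hind
    obtain ⟨f⟩ : Nonempty (Fin (Nat.card X) × Fin (Nat.card Y) ≃ E) := Finite.card_eq.1 (by
      simp [card_eq_mul_of_ncard_fiber u hu])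
    have : Nonempty (Fin (Nat.card X)) := (Finite.equivFin X).symm.nonempty
    refine HasPairingInvolution.of_equiv f (Finite.equivFin X)
      (Finite.equivFin Y) (hConnBalls _ _ Nat.card_pos Nat.card_pos _ _
        (fun x => (ncard_fiber_comp_equiv u _ _ x).trans (hu _))
        (fun y => (ncard_fiber_comp_equiv v _ _ y).trans (hv _))
        (IsIndecomposable.connected ?_))
    exact hind.comp_equiv _ _ _
end

section
/- Let V be a finite type, G : SimpleGraph V, and L ⊆ V a set of vertices (the vertices carrying loops). Then the following are equivalent: (1) there exists an involution θ : V → V (θ ∘ θ = id) such that for every v : V, either θ v = v and v ∈ L, or θ v ≠ v and G.Adj v (θ v); (2) for every finite set U ⊆ V, the number of connected components of the subgraph of G induced on V \ U that have an odd number of vertices and contain no vertex of L is at most |U|. -/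
namespace SimpleGraph

lemma ConnectedComponent.image_supp_map_eq {V W : Type*} {G : SimpleGraph V} {H : SimpleGraph W}
    (φ : G →g H) (d : G.ConnectedComponent)
    (hφ : ∀ x ∈ d.supp, ∀ y, H.Adj (φ x) y → ∃ x', G.Adj x x' ∧ φ x' = y) :
    φ '' d.supp = (d.map φ).supp := by
  induction d using ConnectedComponent.ind with
  | h v =>
    ext y
    constructor
    · rintro ⟨x, hx, rfl⟩
      exact ConnectedComponent.eq.2 ((ConnectedComponent.eq.1 hx).map φ)
    · intro hy
      have hr : H.Reachable (φ v) y := (ConnectedComponent.eq.1 hy).symm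
      rw [reachable_iff_reflTransGen] at hr
      induction hr with
      | refl => exact ⟨v, rfl, rfl⟩
      | @tail b c hb hbc ih =>
        have hreach : H.Reachable (φ v) b := (reachable_iff_reflTransGen _ _).2 hb
        obtain ⟨x, hx, rfl⟩ := ih (ConnectedComponent.eq.2 hreach.symm)
        obtain ⟨x', hadj, rfl⟩ := hφ x hx c hbc
        exact ⟨x', (mem_supp_congr_adj _ hadj).1 hx, rfl⟩

/-- The join of `G`, along the vertices of `L`, with a complete graph on a second copy of the
vertex set: every vertex of `L` is adjacent to every vertex of the second copy. -/
def cliqueJoin {V : Type*} (G : SimpleGraph V) (L : Set V) : SimpleGraph (V ⊕ V) where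
  Adj
    | .inl u, .inl v => G.Adj u v
    | .inl u, .inr _ => u ∈ L
    | .inr _, .inl v => v ∈ L
    | .inr a, .inr b => a ≠ b
  symm := ⟨by
    rintro (u | u) (v | v) h
    · exact G.adj_symm h
    · exact h
    · exact h
    · exact Ne.symm h⟩
  loopless := ⟨by
    rintro (u | u) h
    · exact G.loopless.irrefl u h
    · exact h rfl⟩

lemma exists_involution_of_isPerfectMatching_cliqueJoin {V : Type*} {G : SimpleGraph V}
    {L : Set V} {M : (G.cliqueJoin L).Subgraph} (hM : M.IsPerfectMatching) :
    ∃ θ : V → V, θ ∘ θ = id ∧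
      ∀ v : V, (θ v = v ∧ v ∈ L) ∨ (θ v ≠ v ∧ G.Adj v (θ v)) := by
  choose p hp hpu using Subgraph.isPerfectMatching_iff.1 hM
  refine ⟨fun v ↦ (p (.inl v)).elim id fun _ ↦ v, ?_, fun v ↦ ?_⟩
  · ext v
    rcases h : p (.inl v) with w | w
    · have : p (.inl w) = .inl v := (hpu _ _ (h ▸ hp (.inl v)).symm).symm
      simp [h, this]
    · simp [h]
  · have hadj := (hp (.inl v)).adj_sub
    rcases h : p (.inl v) with w | w
    · rw [h] at hadj
      have hadj' : G.Adj v w := hadj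
      exact .inr (by simpa [h] using And.intro hadj'.ne' hadj')
    · rw [h] at hadj
      have hv : v ∈ L := hadj
      exact .inl (by simpa [h] using hv)

/-- The odd connected components of `G` outside `U` which avoid `L`. -/
abbrev looplessOddComponents {V : Type*} (G : SimpleGraph V) (L U : Set V) :
    Set (G.induce Uᶜ).ConnectedComponent :=
  {c | Odd c.supp.ncard ∧ ∀ v ∈ c.supp, (v : V) ∉ L}

/-- The inclusion of `G` in its clique join, after deletion of vertices. -/
def cliqueJoinInl {V : Type*} (G : SimpleGraph V) (L : Set V) (u : Set (V ⊕ V)) :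
    G.induce (Sum.inl ⁻¹' u)ᶜ →g ((⊤ : (G.cliqueJoin L).Subgraph).deleteVerts u).coe where
  toFun v := ⟨.inl v.1, trivial, v.2⟩
  map_rel' {a b} h := by
    have h' : (G.cliqueJoin L).Adj (.inl a.1) (.inl b.1) := h
    simpa [h'] using ⟨a.2, b.2⟩

/-- The components of the clique join, after deletion of vertices, which meet the clique
or `L`. -/
abbrev cliqueJoinMeeting {V : Type*} (G : SimpleGraph V) (L : Set V) (u : Set (V ⊕ V)) :
    Set ((⊤ : (G.cliqueJoin L).Subgraph).deleteVerts u).coe.ConnectedComponent :=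
  {c | ∃ x ∈ c.supp, (∃ w, x.1 = .inr w) ∨ ∃ l ∈ L, x.1 = .inl l}

lemma oddComponents_cliqueJoin_subset {V : Type*} (G : SimpleGraph V) (L : Set V)
    (u : Set (V ⊕ V)) :
    ((⊤ : (G.cliqueJoin L).Subgraph).deleteVerts u).coe.oddComponents ⊆
      ConnectedComponent.map (G.cliqueJoinInl L u) ''
        G.looplessOddComponents L (Sum.inl ⁻¹' u) ∪ G.cliqueJoinMeeting L u := by
  intro c hc
  by_cases hB : c ∈ G.cliqueJoinMeeting L u
  · exact .inr hB
  refine .inl ?_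
  obtain ⟨⟨x, hx⟩, rfl⟩ := c.exists_rep
  rcases x with v | w
  swap
  · exact (hB ⟨_, rfl, .inl ⟨w, rfl⟩⟩).elim
  set φ := G.cliqueJoinInl L u
  let d := (G.induce (Sum.inl ⁻¹' u)ᶜ).connectedComponentMk ⟨v, hx.2⟩
  have hmem : ∀ x ∈ d.supp, φ x ∈ (d.map φ).supp := fun x hx ↦
    ConnectedComponent.eq.2 ((ConnectedComponent.eq.1 hx).map φ)
  have hsupp : φ '' d.supp = (d.map φ).supp := by
    refine ConnectedComponent.image_supp_map_eq φ d ?_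
    rintro x hxd ⟨y | y, hy⟩ hadj
    · have hxy : (G.cliqueJoin L).Adj (.inl x) (.inl y) := Subgraph.coe_adj_sub _ _ _ hadj
      exact ⟨⟨y, hy.2⟩, hxy, rfl⟩
    · exact (hB ⟨_, (ConnectedComponent.mem_supp_congr_adj _ hadj).1 (hmem x hxd),
        .inl ⟨y, rfl⟩⟩).elim
  refine ⟨d, ⟨?_, fun x hxd hxL ↦ hB ⟨_, hmem x hxd, .inr ⟨x, hxL, rfl⟩⟩⟩, rfl⟩
  have hinj : Function.Injective φ := fun a b hab ↦
    Subtype.ext (Sum.inl_injective (congrArg Subtype.val hab))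
  rw [← Set.ncard_image_of_injective _ hinj, hsupp]
  exact hc

lemma ncard_cliqueJoinMeeting_le {V : Type*} [Finite V] (G : SimpleGraph V) (L : Set V)
    {u : Set (V ⊕ V)} (hu : ∀ w, .inr w ∈ u) :
    (G.cliqueJoinMeeting L u).ncard ≤ Nat.card V := by
  have hex : ∀ c : G.cliqueJoinMeeting L u, ∃ l : V, ∃ x ∈ c.1.supp, x.1 = .inl l := by
    rintro ⟨c, x, hx, ⟨w, hw⟩ | ⟨l, -, hl⟩⟩
    · exact (x.2.2 (hw ▸ hu w)).elim
    · exact ⟨l, x, hx, hl⟩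
  choose f x hx hf using hex
  refine Nat.card_le_card_of_injective f fun c d hcd ↦ Subtype.ext ?_
  have : x c = x d := Subtype.ext (by rw [hf, hf, hcd])
  rw [← ConnectedComponent.mem_supp_iff _ _ |>.1 (hx c), this]
  exact hx d

lemma ncard_cliqueJoinMeeting_le_one {V : Type*} [Finite V] (G : SimpleGraph V) (L : Set V)
    {u : Set (V ⊕ V)} {k : V} (hk : .inr k ∉ u) :
    (G.cliqueJoinMeeting L u).ncard ≤ 1 := by
  have hk' : Sum.inr k ∈ ((⊤ : (G.cliqueJoin L).Subgraph).deleteVerts u).verts := ⟨trivial, hk⟩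
  rw [← Set.ncard_singleton
    (((⊤ : (G.cliqueJoin L).Subgraph).deleteVerts u).coe.connectedComponentMk ⟨_, hk'⟩)]
  refine Set.ncard_le_ncard ?_
  rintro c ⟨⟨x, hx⟩, rfl, h⟩
  refine ConnectedComponent.eq.2 ?_
  by_cases hxk : x = .inr k
  · subst hxk; rfl
  refine Adj.reachable ?_
  have : (G.cliqueJoin L).Adj x (.inr k) := by
    rcases h with ⟨w, rfl⟩ | ⟨l, hl, rfl⟩
    · exact fun h ↦ hxk (congrArg _ h)
    · exact hl
  simpa [this] using ⟨hx.2, hk⟩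

lemma ncard_eq_ncard_preimage_add {V : Type*} [Finite V] (u : Set (V ⊕ V)) :
    u.ncard = (Sum.inl ⁻¹' u).ncard + (Sum.inr ⁻¹' u).ncard := by
  rw [← Set.ncard_image_of_injective (Sum.inl ⁻¹' u) Sum.inl_injective,
    ← Set.ncard_image_of_injective (Sum.inr ⁻¹' u) Sum.inr_injective, ← Set.ncard_union_eq,
    Set.image_preimage_inl_union_image_preimage_inr]
  exact Set.disjoint_image_inl_image_inr

lemma not_isTutteViolator_cliqueJoin {V : Type*} [Finite V] {G : SimpleGraph V} {L : Set V}
    (h : ∀ U : Set V, (G.looplessOddComponents L U).ncard ≤ U.ncard) (u : Set (V ⊕ V)) :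
    ¬ (G.cliqueJoin L).IsTutteViolator u := by
  rw [IsTutteViolator, not_lt, ncard_eq_ncard_preimage_add u]
  have hle : ((⊤ : (G.cliqueJoin L).Subgraph).deleteVerts u).coe.oddComponents.ncard ≤
      (Sum.inl ⁻¹' u).ncard + (G.cliqueJoinMeeting L u).ncard :=
    (Set.ncard_le_ncard (G.oddComponents_cliqueJoin_subset L u)).trans <|
      (Set.ncard_union_le _ _).trans <|
        add_le_add_left ((Set.ncard_image_le (Set.toFinite _)).trans (h _)) _
  by_cases! hu : ∀ w, .inr w ∈ u
  · have hW : Sum.inr ⁻¹' u = Set.univ := Set.eq_univ_of_forall hu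
    have := G.ncard_cliqueJoinMeeting_le L hu
    rw [hW, Set.ncard_univ]
    lia
  · obtain ⟨k, hk⟩ := hu
    have hone := G.ncard_cliqueJoinMeeting_le_one L hk
    by_cases hW : (Sum.inr ⁻¹' u).ncard = 0
    · have hodd := odd_ncard_oddComponents
        ((⊤ : (G.cliqueJoin L).Subgraph).deleteVerts u).coe
      have hcard : Nat.card ((⊤ : (G.cliqueJoin L).Subgraph).deleteVerts u).verts + u.ncard =
          Nat.card V + Nat.card V := by
        rw [Nat.card_coe_set_eq, Subgraph.deleteVerts_verts, Subgraph.verts_top,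
          Set.ncard_sdiff_add_ncard_of_subset (Set.subset_univ u), Set.ncard_univ, Nat.card_sum]
      rw [ncard_eq_ncard_preimage_add u] at hcard
      rw [Nat.odd_iff, Nat.odd_iff] at hodd
      lia
    · lia

lemma _root_.Set.even_ncard_of_involution {α : Type*} {s : Set α} (hs : s.Finite) (f : α → α)
    (hmem : ∀ a ∈ s, f a ∈ s) (hne : ∀ a ∈ s, f a ≠ a) (hinv : ∀ a ∈ s, f (f a) = a) :
    Even s.ncard := by
  lift s to Finset α using hs
  have : ∑ _a ∈ s, (1 : ZMod 2) = 0 :=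
    Finset.sum_involution (fun a _ ↦ f a) (fun _ _ ↦ by decide) (fun a ha _ ↦ hne a ha) hmem hinv
  rw [Set.ncard_coe_finset, even_iff_two_dvd, ← ZMod.natCast_eq_zero_iff]
  simpa using this

lemma ncard_looplessOddComponents_le {V : Type*} [Finite V] {G : SimpleGraph V} {L : Set V}
    {θ : V → V} (hinv : Function.Involutive θ)
    (hθ : ∀ v : V, (θ v = v ∧ v ∈ L) ∨ (θ v ≠ v ∧ G.Adj v (θ v))) (U : Set V) :
    (G.looplessOddComponents L U).ncard ≤ U.ncard := by
  have hex : ∀ c : G.looplessOddComponents L U, ∃ v ∈ c.1.supp, θ v ∈ U := by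
    rintro ⟨c, hodd, hL⟩
    by_contra! hU
    refine Nat.not_even_iff_odd.2 hodd ?_
    rw [← Set.ncard_image_of_injective _ Subtype.val_injective]
    have hadj : ∀ v ∈ c.supp, G.Adj v (θ v) := fun v hv ↦
      ((hθ v).resolve_left fun h ↦ hL v hv h.2).2
    refine Set.even_ncard_of_involution (Set.toFinite _) θ ?_ ?_ fun v _ ↦ hinv v
    · rintro _ ⟨v, hv, rfl⟩
      have : (G.induce Uᶜ).Adj v ⟨θ v, hU v hv⟩ := hadj v hv
      exact ⟨⟨θ v, hU v hv⟩, (c.mem_supp_congr_adj this).1 hv, rfl⟩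
    · rintro _ ⟨v, hv, rfl⟩
      exact (hadj v hv).ne'
  choose f hf hfU using hex
  refine Nat.card_le_card_of_injective (fun c ↦ (⟨θ (f c), hfU c⟩ : U)) fun c d hcd ↦
    Subtype.ext ?_
  have : f c = f d := Subtype.ext (hinv.injective (congrArg Subtype.val hcd))
  exact ConnectedComponent.eq_of_common_vertex (hf c) (this ▸ hf d)

end SimpleGraph

/-- Lemma 10: Tutte's theorem for graphs with loops. A graph `G` with set
of looped vertices `L` has a perfect matching (loops allowed) iff for every vertex set `U`
the graph induced on the complement of `U` has at most `|U|` odd connected components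
containing no looped vertex. -/
theorem stmt15 (V : Type) [Fintype V] (G : SimpleGraph V) (L : Set V) :
    (∃ θ : V → V, θ ∘ θ = id ∧
      ∀ v : V, (θ v = v ∧ v ∈ L) ∨ (θ v ≠ v ∧ G.Adj v (θ v)))
    ↔ ∀ U : Finset V,
      Set.ncard {c : (G.induce ((↑U : Set V)ᶜ)).ConnectedComponent |
        Odd c.supp.ncard ∧ ∀ v ∈ c.supp, (v : V) ∉ L} ≤ U.card := by
  constructor
  · rintro ⟨θ, hinv, hθ⟩ U
    rw [← Set.ncard_coe_finset]
    exact SimpleGraph.ncard_looplessOddComponents_le (θ := θ) (congrFun hinv) hθ (U : Set V)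
  · intro h
    obtain ⟨M, hM⟩ := SimpleGraph.tutte.2 <|
      SimpleGraph.not_isTutteViolator_cliqueJoin (G := G) (L := L) fun U ↦ by
        lift U to Finset V using U.toFinite
        rw [Set.ncard_coe_finset]
        exact h U
    exact SimpleGraph.exists_involution_of_isPerfectMatching_cliqueJoin hM
end

section
/- Let t be an odd positive integer, κ ≥ 0 a real number, and λ : Fin t → ℝ a function with |λ i| ≤ κ for all i and ∑ i, λ i = 0. Then ∑ i, (λ i)² ≤ (t - 1) · κ². -/
/-- If `f` sums to zero and is bounded by `κ` in absolute value, then its `ℓ¹` norm is at most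
`2κ` times the size of any set off which `f` is nonpositive. -/
theorem sum_abs_le_card_mul_of_sum_eq_zero {ι : Type*} [Fintype ι] {κ : ℝ} {f : ι → ℝ}
    (hf : ∀ i, |f i| ≤ κ) (hsum : ∑ i, f i = 0) (p : ι → Prop) [DecidablePred p]
    (hp : ∀ i, ¬ p i → f i ≤ 0) :
    ∑ i, |f i| ≤ (Finset.univ.filter p).card * (2 * κ) := by
  calc ∑ i, |f i| = ∑ i, (|f i| + f i) := by rw [Finset.sum_add_distrib, hsum, add_zero]
    _ ≤ ∑ i, if p i then 2 * κ else 0 := by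
        refine Finset.sum_le_sum fun i _ => ?_
        split_ifs with h
        · linarith [hf i, le_abs_self (f i)]
        · rw [abs_of_nonpos (hp i h), neg_add_cancel]
    _ = (Finset.univ.filter p).card * (2 * κ) := by
        rw [← Finset.sum_filter, Finset.sum_const, nsmul_eq_mul]

/-- Lemma 11: if `t` is odd and `λ₁, …, λ_t ∈ [-κ, κ]` sum to zero,
then `∑ λᵢ² ≤ (t-1)·κ²`. -/
theorem stmt16 (t : ℕ) (ht : 0 < t) (htodd : Odd t) (κ : ℝ) (hκ : 0 ≤ κ)
    (l : Fin t → ℝ) (hl : ∀ i, |l i| ≤ κ) (hsum : ∑ i, l i = 0) :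
    ∑ i, (l i) ^ 2 ≤ ((t : ℝ) - 1) * κ ^ 2 := by
  have hpos := sum_abs_le_card_mul_of_sum_eq_zero hl hsum (fun i => 0 < l i)
    fun i hi => not_lt.mp hi
  have hneg := sum_abs_le_card_mul_of_sum_eq_zero (f := fun i => -l i) (κ := κ)
    (by simpa using hl) (by simpa using hsum) (fun i => ¬ 0 < l i)
    (fun i hi => by simpa using (not_not.mp hi).le)
  simp only [abs_neg] at hneg
  have hcard := Finset.card_filter_add_card_filter_not (s := (Finset.univ : Finset (Fin t)))
    (fun i => 0 < l i)
  rw [Finset.card_univ, Fintype.card_fin] at hcard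
  have habs : ∑ i, |l i| ≤ ((t : ℝ) - 1) * κ := by
    obtain ⟨m, rfl⟩ := htodd
    have hm : ∀ c : ℕ, c ≤ m → (c : ℝ) * (2 * κ) ≤ (((2 * m + 1 : ℕ) : ℝ) - 1) * κ := by
      intro c hc
      have hc' : (c : ℝ) ≤ m := by exact_mod_cast hc
      push_cast
      nlinarith
    rcases le_or_gt (Finset.univ.filter fun i => 0 < l i).card m with h | h
    · exact hpos.trans (hm _ h)
    · exact hneg.trans (hm _ (by omega))
  calc ∑ i, (l i) ^ 2 ≤ ∑ i, κ * |l i| := by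
        refine Finset.sum_le_sum fun i _ => ?_
        rw [← sq_abs, sq]
        exact mul_le_mul_of_nonneg_right (hl i) (abs_nonneg _)
    _ = κ * ∑ i, |l i| := by rw [Finset.mul_sum]
    _ ≤ κ * (((t : ℝ) - 1) * κ) := mul_le_mul_of_nonneg_left habs hκ
    _ = ((t : ℝ) - 1) * κ ^ 2 := by ring
end

section
/- Let n, k be positive integers. The following are equivalent: (1) for every biregular pair (u, v) on parameters (n, k) there exists an involution ι : Fin n × Fin k → Fin n × Fin k (ι ∘ ι = id) such that for every (x, y) : Fin n × Fin k there is exactly one e with u (ι e) = x and v e = y; (2) every permutation σ of Fin n × Fin k can be written as σ = ι ∘ ξ ∘ η where ι is an involution, ξ preserves the second coordinate (i.e., (ξ e).2 = e.2 for all e), and η preserves the first coordinate (i.e., (η e).1 = e.1 for all e); (3) every permutation σ of Fin n × Fin k can be written as σ = ι ∘ ξ ∘ η where ι is an involution, ξ satisfies (ξ e).2 = β e.2 for all e, for some permutation β of Fin k, and η satisfies (η e).1 = α e.1 for all e, for some permutation α of Fin n. -/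
/-- The fibers of the first projection of `A × Fin m` have `m` elements. -/
theorem natCard_fiber_fst {E A : Type*} {m : ℕ} (π : E ≃ A × Fin m) (a : A) :
    Nat.card {e | (π e).1 = a} = m := by
  let F : {e // (π e).1 = a} ≃ {p : A × Fin m // p.1 = a} :=
    π.subtypeEquiv fun _ => Iff.rfl
  let G : {p : A × Fin m // p.1 = a} ≃ Fin m :=
    { toFun := fun p => p.1.2
      invFun := fun i => ⟨(a, i), rfl⟩
      left_inv := by rintro ⟨⟨_, i⟩, rfl⟩; rfl
      right_inv := fun _ => rfl }
  exact (Nat.card_congr (F.trans G)).trans (Nat.card_fin m)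

/-- A map all of whose fibers have `m` elements is, up to a bijection, a projection. -/
theorem exists_equiv_prod_fst_eq {E A : Type*} [Finite E] (m : ℕ) (f : E → A)
    (hf : ∀ a, Nat.card {e | f e = a} = m) :
    ∃ π : E ≃ A × Fin m, ∀ e, (π e).1 = f e := by
  have h : ∀ a, Nonempty ({e // f e = a} ≃ Fin m) := fun a =>
    (Finite.card_eq.mp (by rw [Nat.card_fin]; exact hf a))
  exact ⟨(Equiv.sigmaFiberEquiv f).symm.trans
    ((Equiv.sigmaCongrRight fun a => (h a).some).trans (Equiv.sigmaEquivProd A (Fin m))), fun e => rfl⟩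

/-- `σ` factors as an involution `ι`, a permutation preserving the second coordinate and one
preserving the first, as soon as `e ↦ ((σ⁻¹ (ι e)).1, e.2)` is bijective. -/
theorem factorization_of_bijective {A B : Type*} (σ : Equiv.Perm (A × B)) (ι : A × B → A × B)
    (hι : ι ∘ ι = id) (h : Function.Bijective fun e => ((σ.symm (ι e)).1, e.2)) :
    ∃ ξ η : Equiv.Perm (A × B), (∀ e, (ξ e).2 = e.2) ∧ (∀ e, (η e).1 = e.1) ∧
      ⇑σ = ι ∘ ⇑ξ ∘ ⇑η := by
  have hinv : Function.Involutive ι := congrFun hι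
  let θ : Equiv.Perm (A × B) := Equiv.ofBijective _ h
  let τ : Equiv.Perm (A × B) := σ.trans hinv.toPerm
  refine ⟨θ.symm, τ.trans θ, fun e => ?_, fun e => ?_, ?_⟩
  · have hθ : ∀ e, (θ e).2 = e.2 := fun _ => rfl
    rw [← hθ, θ.apply_symm_apply]
  · change (σ.symm (ι (ι (σ e)))).1 = e.1
    rw [hinv, σ.symm_apply_apply]
  · funext e
    change σ e = ι (θ.symm (θ (ι (σ e))))
    rw [θ.symm_apply_apply, hinv]

/-- The converse of `factorization_of_bijective`. -/
theorem bijective_of_factorization {A B : Type*} (σ : Equiv.Perm (A × B)) (ι : A × B → A × B)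
    (hι : ι ∘ ι = id) (ξ η : Equiv.Perm (A × B)) (hξ : ∀ e, (ξ e).2 = e.2)
    (hη : ∀ e, (η e).1 = e.1) (h : ⇑σ = ι ∘ ⇑ξ ∘ ⇑η) :
    Function.Bijective fun e => ((σ.symm (ι e)).1, e.2) := by
  have hinv : Function.Involutive ι := congrFun hι
  convert ξ.symm.bijective using 1
  funext e
  have h1 : σ.symm (ι e) = η.symm (ξ.symm e) := by
    rw [Equiv.symm_apply_eq, h]
    simp
  refine Prod.ext ?_ ?_
  · change (σ.symm (ι e)).1 = _
    rw [h1, ← hη, Equiv.apply_symm_apply]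
  · change e.2 = _
    rw [← hξ (ξ.symm e), Equiv.apply_symm_apply]

/-- Unique solvability of `f e = x ∧ g e = y` is bijectivity of `e ↦ (f e, g e)`. -/
theorem bijective_prodMk_iff {E A B : Type*} (f : E → A) (g : E → B) :
    (Function.Bijective fun e => (f e, g e)) ↔ ∀ x y, ∃! e, f e = x ∧ g e = y := by
  simp [Function.bijective_iff_existsUnique]


/-- the group-theoretic reformulations of Conjecture 3: the balls
conjecture for parameters `(n, k)` is equivalent to `I · S_n^k · S_k^n = S_{n,k}` and to
`I · (S_n ≀ S_k) · (S_k ≀ S_n) = S_{n,k}`. -/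
theorem stmt17 (n k : ℕ) (hn : 0 < n) (hk : 0 < k) :
    ((∀ (u : Fin n × Fin k → Fin n) (v : Fin n × Fin k → Fin k),
        (∀ x : Fin n, Nat.card {e : Fin n × Fin k | u e = x} = k) →
        (∀ y : Fin k, Nat.card {e : Fin n × Fin k | v e = y} = n) →
        ∃ ι : Fin n × Fin k → Fin n × Fin k, ι ∘ ι = id ∧
          ∀ (x : Fin n) (y : Fin k), ∃! e : Fin n × Fin k, u (ι e) = x ∧ v e = y)
      ↔
      (∀ σ : Equiv.Perm (Fin n × Fin k),
        ∃ (ι : Fin n × Fin k → Fin n × Fin k) (ξ η : Equiv.Perm (Fin n × Fin k)),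
          ι ∘ ι = id ∧ (∀ e : Fin n × Fin k, (ξ e).2 = e.2) ∧
          (∀ e : Fin n × Fin k, (η e).1 = e.1) ∧ ⇑σ = ι ∘ ⇑ξ ∘ ⇑η))
    ∧
    ((∀ σ : Equiv.Perm (Fin n × Fin k),
        ∃ (ι : Fin n × Fin k → Fin n × Fin k) (ξ η : Equiv.Perm (Fin n × Fin k)),
          ι ∘ ι = id ∧ (∀ e : Fin n × Fin k, (ξ e).2 = e.2) ∧
          (∀ e : Fin n × Fin k, (η e).1 = e.1) ∧ ⇑σ = ι ∘ ⇑ξ ∘ ⇑η)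
      ↔
      (∀ σ : Equiv.Perm (Fin n × Fin k),
        ∃ (ι : Fin n × Fin k → Fin n × Fin k) (ξ η : Equiv.Perm (Fin n × Fin k)),
          ι ∘ ι = id ∧ (∃ β : Equiv.Perm (Fin k), ∀ e : Fin n × Fin k, (ξ e).2 = β e.2) ∧
          (∃ α : Equiv.Perm (Fin n), ∀ e : Fin n × Fin k, (η e).1 = α e.1) ∧
          ⇑σ = ι ∘ ⇑ξ ∘ ⇑η)) := by
  refine ⟨⟨fun H σ => ?_, fun H u v hu hv => ?_⟩, fun H σ => ?_, fun H σ => ?_⟩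
  · obtain ⟨ι, hι, h⟩ := H (fun e => (σ.symm e).1) Prod.snd
      (natCard_fiber_fst σ.symm) (natCard_fiber_fst (Equiv.prodComm _ _))
    obtain ⟨ξ, η, h'⟩ := factorization_of_bijective σ ι hι ((bijective_prodMk_iff _ _).mpr h)
    exact ⟨ι, ξ, η, hι, h'⟩
  · obtain ⟨ρ, hρ⟩ := exists_equiv_prod_fst_eq k u hu
    obtain ⟨π', hπ'⟩ := exists_equiv_prod_fst_eq n v hv
    let π : Equiv.Perm (Fin n × Fin k) := π'.trans (Equiv.prodComm _ _)
    have hπ : ∀ e, (π e).2 = v e := hπ'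
    obtain ⟨ι, ξ, η, hι, hξ, hη, h⟩ := H (ρ.symm.trans π)
    have hinv : Function.Involutive ι := congrFun hι
    refine ⟨fun e => π.symm (ι (π e)), ?_, (bijective_prodMk_iff _ _).mp ?_⟩
    · funext e
      simp [hinv _]
    · convert (bijective_of_factorization _ ι hι ξ η hξ hη h).comp π.bijective using 1
      funext e
      simp [← hρ, ← hπ]
  · obtain ⟨ι, ξ, η, hι, hξ, hη, h⟩ := H σ
    exact ⟨ι, ξ, η, hι, ⟨1, hξ⟩, ⟨1, hη⟩, h⟩
  · obtain ⟨ι, ξ, η, hι, ⟨β, hξ⟩, ⟨α, hη⟩, h⟩ := H σ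
    refine ⟨ι, (Equiv.prodCongr α β.symm).trans ξ, η.trans (Equiv.prodCongr α.symm β), hι,
      fun e => ?_, fun e => ?_, ?_⟩
    · simp [hξ]
    · simp [hη]
    · funext e
      simp [h, Prod.map_map]
end

section
/- Let n, k be positive integers. Suppose that for every biregular pair (u, v) on parameters (n, k) there exists an involution ι : Fin n × Fin k → Fin n × Fin k (ι ∘ ι = id) such that for every (x, y) : Fin n × Fin k there is exactly one e with u (ι e) = x and v e = y. Then for every matrix M : Matrix (Fin n) (Fin k) ℕ in which every row sums to k and every column sums to n, there exists an involution θ : Fin n × Fin k → Fin n × Fin k (θ ∘ θ = id) such that M p.1 (θ p).2 · M (θ p).1 p.2 ≠ 0 for every p : Fin n × Fin k. -/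
/-- A matrix of naturals with total sum `card β` is the multiplicity matrix of a bipartite
multigraph with edge set `β`: the maps `u`, `v` send an edge to its two endpoints, the row and
column sums count the edges at a vertex, and every edge joins a pair with nonzero entry. -/
theorem exists_edge_endpoints {m n β : Type*} [Fintype m] [Fintype n] [Fintype β]
    (M : m → n → ℕ) (hM : ∑ i, ∑ j, M i j = Fintype.card β) :
    ∃ (u : β → m) (v : β → n),
      (∀ i, Nat.card {e | u e = i} = ∑ j, M i j) ∧
      (∀ j, Nat.card {e | v e = j} = ∑ i, M i j) ∧
      ∀ e, M (u e) (v e) ≠ 0 := by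
  have hcard : Fintype.card β = Fintype.card (Σ p : m × n, Fin (M p.1 p.2)) := by
    simp [← hM, Fintype.sum_prod_type]
  let f := Fintype.equivOfCardEq hcard
  refine ⟨fun e => (f e).1.1, fun e => (f e).1.2, fun i => ?_, fun j => ?_, fun e h => ?_⟩
  · let g : {a : Σ p : m × n, Fin (M p.1 p.2) | a.1.1 = i} ≃ Σ j : n, Fin (M i j) :=
      { toFun := fun e => ⟨e.1.1.2, e.1.2.cast (congrArg (M · e.1.1.2) e.2)⟩
        invFun := fun a => ⟨⟨(i, a.1), a.2⟩, rfl⟩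
        left_inv := by rintro ⟨⟨⟨i, j⟩, a⟩, rfl⟩; rfl
        right_inv := fun _ => rfl }
    refine (Nat.card_congr ((f.subtypeEquiv fun _ => Iff.rfl).trans g)).trans ?_
    simp
  · let g : {a : Σ p : m × n, Fin (M p.1 p.2) | a.1.2 = j} ≃ Σ i : m, Fin (M i j) :=
      { toFun := fun e => ⟨e.1.1.1, e.1.2.cast (congrArg (M e.1.1.1) e.2)⟩
        invFun := fun a => ⟨⟨(a.1, j), a.2⟩, rfl⟩
        left_inv := by rintro ⟨⟨⟨i, j⟩, a⟩, rfl⟩; rfl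
        right_inv := fun _ => rfl }
    refine (Nat.card_congr ((f.subtypeEquiv fun _ => Iff.rfl).trans g)).trans ?_
    simp
  · exact (h ▸ (f e).2).elim0

/-- for fixed `n`, `k`, Conjecture 3 (balls) implies Conjecture 2: every
`n × k` matrix of naturals with row sums `k` and column sums `n` yields a multigraph
`M ⊗ Mᵀ` with a perfect matching (loops allowed). -/
theorem stmt18 (n k : ℕ) (hn : 0 < n) (hk : 0 < k)
    (hBalls : ∀ (u : Fin n × Fin k → Fin n) (v : Fin n × Fin k → Fin k),
      (∀ x : Fin n, Nat.card {e : Fin n × Fin k | u e = x} = k) →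
      (∀ y : Fin k, Nat.card {e : Fin n × Fin k | v e = y} = n) →
      ∃ ι : Fin n × Fin k → Fin n × Fin k, ι ∘ ι = id ∧
        ∀ (x : Fin n) (y : Fin k), ∃! e : Fin n × Fin k, u (ι e) = x ∧ v e = y) :
    ∀ M : Matrix (Fin n) (Fin k) ℕ,
      (∀ i, ∑ j, M i j = k) → (∀ j, ∑ i, M i j = n) →
      ∃ θ : Fin n × Fin k → Fin n × Fin k, θ ∘ θ = id ∧
        ∀ p : Fin n × Fin k, M p.1 (θ p).2 * M (θ p).1 p.2 ≠ 0 := by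
  intro M hrow hcol
  obtain ⟨u, v, hu, hv, huv⟩ :=
    exists_edge_endpoints M (β := Fin n × Fin k) (by simp [hrow])
  obtain ⟨ι, hι, hex⟩ :=
    hBalls u v (fun x => (hu x).trans (hrow x)) (fun y => (hv y).trans (hcol y))
  have hbij : Function.Bijective fun e => (u (ι e), v e) :=
    Function.bijective_iff_existsUnique _ |>.2 fun p => by
      simpa only [Prod.ext_iff] using hex p.1 p.2
  let φ := Equiv.ofBijective _ hbij
  have hιι : ∀ e, ι (ι e) = e := congrFun hι
  refine ⟨φ ∘ ι ∘ φ.symm, ?_, fun p => ?_⟩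
  · funext p
    simp [hιι]
  · obtain ⟨e, rfl⟩ := φ.surjective p
    simp only [Function.comp_apply, Equiv.symm_apply_apply]
    change M (u (ι e)) (v (ι e)) * M (u (ι (ι e))) (v e) ≠ 0
    rw [hιι]
    exact mul_ne_zero (huv _) (huv _)
end

section
/- Let t be an odd positive integer and let M : Matrix (Fin t) (Fin t) ℝ have nonnegative entries with M i i = 0 for all i and with every row sum at most 1 (∑ j, M i j ≤ 1 for all i). Then ∑_{i < j} M i j · M j i ≤ (t - 1)/2. -/
/-- The total weight of the functions `f` with `f i = j` and `f j = i`, where `f` has weight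
`∏ k, w k (f k)` for a row-stochastic `w`, is `w i j * w j i`. -/
lemma sum_prod_ite_swap {α R : Type*} [Fintype α] [DecidableEq α] [CommSemiring R]
    (w : α → α → R) (hw : ∀ i, ∑ j, w i j = 1) {i j : α} (hij : i ≠ j) :
    ∑ f : α → α, (if f i = j ∧ f j = i then ∏ k, w k (f k) else 0) = w i j * w j i := by
  have h := Fintype.prod_sum
    (fun k l : α => if (k = i → l = j) ∧ (k = j → l = i) then w k l else 0)
  simp only [Finset.prod_ite_zero] at h
  rw [Finset.prod_eq_mul i j hij (fun k _ hk => by simp [hk.1, hk.2, hw])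
    (by simp) (by simp)] at h
  simp only [hij, hij.symm, true_imp_iff, false_imp_iff, and_true, true_and,
    Finset.sum_ite_eq', Finset.mem_univ, if_true] at h
  rw [h]
  refine Finset.sum_congr rfl fun f _ => if_congr ?_ rfl rfl
  constructor
  · rintro ⟨h₁, h₂⟩ k
    exact ⟨fun hk => hk ▸ h₁, fun hk => hk ▸ h₂⟩
  · intro hf
    exact ⟨(hf i).1 rfl, (hf j).2 rfl⟩

/-- The pairs swapped by a self-map are disjoint. -/
lemma two_mul_card_filter_swap_le {α : Type*} [Fintype α] [LinearOrder α] (f : α → α) :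
    2 * (Finset.univ.filter
      (fun p : α × α => p.1 < p.2 ∧ f p.1 = p.2 ∧ f p.2 = p.1)).card ≤ Fintype.card α := by
  set s := Finset.univ.filter (fun p : α × α => p.1 < p.2 ∧ f p.1 = p.2 ∧ f p.2 = p.1) with hs
  have h₁ : (s.image Prod.fst).card = s.card := by
    refine Finset.card_image_of_injOn ?_
    rintro ⟨a, b⟩ hp ⟨c, d⟩ hq hac
    simp only [hs, Finset.mem_coe, Finset.mem_filter, Finset.mem_univ, true_and] at hp hq hac
    grind
  have h₂ : (s.image Prod.snd).card = s.card := by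
    refine Finset.card_image_of_injOn ?_
    rintro ⟨a, b⟩ hp ⟨c, d⟩ hq hac
    simp only [hs, Finset.mem_coe, Finset.mem_filter, Finset.mem_univ, true_and] at hp hq hac
    grind
  have hd : Disjoint (s.image Prod.fst) (s.image Prod.snd) := by
    rw [Finset.disjoint_left]
    intro x hx hy
    obtain ⟨⟨a, b⟩, hp, rfl⟩ := Finset.mem_image.1 hx
    obtain ⟨⟨c, d⟩, hq, hda⟩ := Finset.mem_image.1 hy
    simp only [hs, Finset.mem_filter, Finset.mem_univ, true_and] at hp hq hda
    obtain ⟨hab, rfl, hfa⟩ := hp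
    obtain ⟨hcd, hfc, hfd⟩ := hq
    subst hda
    rw [hfd] at hab
    exact lt_asymm hab hcd
  have h := Finset.card_le_univ (s.image Prod.fst ∪ s.image Prod.snd)
  rw [Finset.card_union_of_disjoint hd] at h
  omega

/-- the normalized matrix inequality: if `M` is a `t × t` nonnegative
matrix (`t` odd) with zero diagonal and all row sums at most 1, then
`∑_{i<j} M i j * M j i ≤ (t-1)/2`. -/
theorem stmt19 (t : ℕ) (ht : 0 < t) (htodd : Odd t) (M : Matrix (Fin t) (Fin t) ℝ)
    (hMnn : ∀ i j, 0 ≤ M i j) (hdiag : ∀ i, M i i = 0)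
    (hrow : ∀ i, ∑ j, M i j ≤ 1) :
    ∑ p ∈ Finset.univ.filter (fun p : Fin t × Fin t => p.1 < p.2), M p.1 p.2 * M p.2 p.1 ≤
      ((t : ℝ) - 1) / 2 := by
  set w : Fin t → Fin t → ℝ := fun i j => M i j + if j = i then 1 - ∑ l, M i l else 0 with hw
  have hw_nonneg : ∀ i j, 0 ≤ w i j := by
    intro i j
    have := hMnn i j
    have := hrow i
    simp only [hw]
    split_ifs <;> linarith
  have hw_sum : ∀ i, ∑ j, w i j = 1 := by
    intro i
    simp [hw, Finset.sum_add_distrib]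
  have hw_off : ∀ i j, i ≠ j → w i j = M i j := by
    intro i j hij
    simp [hw, hij.symm]
  calc
    _ = ∑ p ∈ Finset.univ.filter (fun p : Fin t × Fin t => p.1 < p.2),
        ∑ f : Fin t → Fin t, (if f p.1 = p.2 ∧ f p.2 = p.1 then ∏ k, w k (f k) else 0) := by
      refine Finset.sum_congr rfl fun p hp => ?_
      have hne := (Finset.mem_filter.1 hp).2.ne
      rw [sum_prod_ite_swap w hw_sum hne, hw_off _ _ hne, hw_off _ _ hne.symm]
    _ = ∑ f : Fin t → Fin t, ((Finset.univ.filter (fun p : Fin t × Fin t =>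
        p.1 < p.2 ∧ f p.1 = p.2 ∧ f p.2 = p.1)).card : ℝ) * ∏ k, w k (f k) := by
      rw [Finset.sum_comm]
      refine Finset.sum_congr rfl fun f _ => ?_
      rw [← Finset.sum_filter, Finset.filter_filter, Finset.sum_const, nsmul_eq_mul]
    _ ≤ ∑ f : Fin t → Fin t, ((t : ℝ) - 1) / 2 * ∏ k, w k (f k) := by
      refine Finset.sum_le_sum fun f _ => mul_le_mul_of_nonneg_right ?_
        (Finset.prod_nonneg fun k _ => hw_nonneg k (f k))
      have h := two_mul_card_filter_swap_le f
      rw [Fintype.card_fin] at h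
      obtain ⟨m, rfl⟩ := htodd
      have h' : (Finset.univ.filter (fun p : Fin (2 * m + 1) × Fin (2 * m + 1) =>
          p.1 < p.2 ∧ f p.1 = p.2 ∧ f p.2 = p.1)).card ≤ m := by omega
      push_cast
      rw [add_sub_cancel_right, mul_div_cancel_left₀ _ two_ne_zero]
      exact_mod_cast h'
    _ = ((t : ℝ) - 1) / 2 := by
      rw [← Finset.mul_sum, ← Fintype.prod_sum]
      simp [hw_sum]
end
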